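/- arXiv:2104.04850 — 2 statements merged into one kernel-verified Lean document; each statement's English description precedes it below -/
import Mathlib

section
/- For all positive reals α, β, K and every integer r ≥ 1 and p_0 < 1, there exist λ > 0 and V_0 such that the following holds. Let H be a weighted r-uniform hypergraph on a finite set V with |V| ≥ V_0, let p ∈ (0, p_0], let η ≥ 0, and suppose that Δ_s(H) ≤ K·(λp)^{s−1}·e(H)/v(H) for every s ∈ {1,…,r}. Let Y = (Y_v)_{v∈V} be the indicator vector of the p-random subset R of V conditioned on the event e(H[R]) ≤ η·p^r·e(H). Then there exists a set W ⊆ V with |W| ≤ α·|V| such that E(W) ≤ β·e(H). -/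
open Classical

noncomputable section

/-- The probability of the configuration `ω ⊆ V` under the product measure in which
each vertex `v` is retained independently with probability `q v`. -/
def pw {V : Type*} [Fintype V] [DecidableEq V] (q : V → ℝ) (ω : Finset V) : ℝ :=
  (∏ v ∈ ω, q v) * ∏ v ∈ ωᶜ, (1 - q v)

/-- The relative entropy `i_p(q) = D_KL(Ber(q) ‖ Ber(p))`.  (In Lean `Real.log 0 = 0`,
which implements the convention `0 · log 0 = 0`.) -/
def ip (p q : ℝ) : ℝ :=
  q * Real.log (q / p) + (1 - q) * Real.log ((1 - q) / (1 - p))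

/-- `e(H[ω])`: the total weight of the edges of the weighted hypergraph `(H, d)`
induced by the set `ω`. -/
def eInd {V : Type*} [DecidableEq V] (H : Finset (Finset V)) (d : Finset V → ℝ)
    (ω : Finset V) : ℝ :=
  ∑ A ∈ H, if A ⊆ ω then d A else 0

/-- `e(H)`: the total weight of the weighted hypergraph `(H, d)`. -/
def eTot {V : Type*} (H : Finset (Finset V)) (d : Finset V → ℝ) : ℝ :=
  ∑ A ∈ H, d A

/-- `deg_H B`: the total weight of the edges of `(H, d)` containing `B`. -/
def degH {V : Type*} [DecidableEq V] (H : Finset (Finset V)) (d : Finset V → ℝ)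
    (B : Finset V) : ℝ :=
  ∑ A ∈ H, if B ⊆ A then d A else 0

/-- The probability of the event `P` for the indicator vector `Y` of the `p`-random
subset `R` of `V` conditioned on the lower-tail event `e(H[R]) ≤ η p^r e(H)`. -/
def nuPr {V : Type*} [Fintype V] [DecidableEq V] (H : Finset (Finset V))
    (d : Finset V → ℝ) (r : ℕ) (p η : ℝ) (P : Finset V → Prop) : ℝ :=
  (∑ ω : Finset V,
      if P ω ∧ eInd H d ω ≤ η * p ^ r * eTot H d then pw (fun _ => p) ω else 0) /
    ∑ ω : Finset V,
      if eInd H d ω ≤ η * p ^ r * eTot H d then pw (fun _ => p) ω else 0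

/-- The conditional expectation `E_W[Y_B] = E[∏_{b ∈ B} Y_b ∣ (Y_w)_{w ∈ W} = 𝟙_s]`
for the conditioned indicator vector `Y`. -/
def condE {V : Type*} [Fintype V] [DecidableEq V] (H : Finset (Finset V))
    (d : Finset V → ℝ) (r : ℕ) (p η : ℝ) (W s B : Finset V) : ℝ :=
  nuPr H d r p η (fun ω => B ⊆ ω ∧ ω ∩ W = s) / nuPr H d r p η (fun ω => ω ∩ W = s)

/-- `D_W(B, b) = E_W[Y_B] − E_W[Y_{B∖{b}}] · E_W[Y_b]`, evaluated at
`(Y_w)_{w ∈ W} = 𝟙_s`. -/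
def DW {V : Type*} [Fintype V] [DecidableEq V] (H : Finset (Finset V))
    (d : Finset V → ℝ) (r : ℕ) (p η : ℝ) (W s B : Finset V) (b : V) : ℝ :=
  condE H d r p η W s B - condE H d r p η W s (B.erase b) * condE H d r p η W s {b}

/-- The quantity `𝓔(W)` from equation `eq:Err-W-def`:
`E[ ∑_{A ∈ H−W} ∑_{B ⊆ A, |B| ≥ 2} ∑_{b ∈ B} d_A D_W(B,b)² / (C(r,|B|)·|B|·p^{2|B|}) ]`,
where the expectation averages over the values `𝟙_s` of `(Y_w)_{w ∈ W}`. -/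
def errW {V : Type*} [Fintype V] [DecidableEq V] (H : Finset (Finset V))
    (d : Finset V → ℝ) (r : ℕ) (p η : ℝ) (W : Finset V) : ℝ :=
  ∑ s ∈ W.powerset, nuPr H d r p η (fun ω => ω ∩ W = s) *
    ∑ A ∈ H.filter (fun A => Disjoint A W),
      ∑ B ∈ A.powerset.filter (fun B => 2 ≤ B.card), ∑ b ∈ B,
        d A * (DW H d r p η W s B b) ^ 2 /
          ((r.choose B.card : ℝ) * (B.card : ℝ) * p ^ (2 * B.card))

/-- The quantity `H(W) = ∑_{v ∈ V∖W} I_p(Y_v ∣ (Y_w)_{w ∈ W})`, written out via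
`I_p(Y_v ∣ S) = ∑_s Pr(S = 𝟙_s) · i_p(Pr(Y_v = 1 ∣ S = 𝟙_s))`. -/
def HW {V : Type*} [Fintype V] [DecidableEq V] (H : Finset (Finset V))
    (d : Finset V → ℝ) (r : ℕ) (p η : ℝ) (W : Finset V) : ℝ :=
  ∑ v ∈ Wᶜ, ∑ s ∈ W.powerset,
    nuPr H d r p η (fun ω => ω ∩ W = s) * ip p (condE H d r p η W s {v})

section Conditioning

/-- The indicator of the event `B ⊆ ω`. -/
def inc {V : Type*} [DecidableEq V] (B ω : Finset V) : ℝ := if B ⊆ ω then 1 else 0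

lemma inc_mul_inc {V : Type*} [DecidableEq V] (B C ω : Finset V) : inc B ω * inc C ω = inc (B ∪ C) ω := by
  unfold inc
  by_cases h1 : B ⊆ ω <;> by_cases h2 : C ⊆ ω <;> simp [Finset.union_subset_iff, h1, h2]

lemma sum_ite_nonneg {V : Type*} [Fintype V] {μ : Finset V → ℝ} (hμ : ∀ ω, 0 ≤ μ ω)
    (P : Finset V → Prop) [DecidablePred P] : 0 ≤ ∑ ω, if P ω then μ ω else 0 :=
  Finset.sum_nonneg fun ω _ => by split_ifs <;> simp [hμ]

lemma eInd_mono {V : Type*} [DecidableEq V] {H : Finset (Finset V)} {d : Finset V → ℝ}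
    (hd : ∀ A ∈ H, 0 < d A) {ω ω' : Finset V} (h : ω ⊆ ω') : eInd H d ω ≤ eInd H d ω' := by
  refine Finset.sum_le_sum fun A hA => ?_
  by_cases h1 : A ⊆ ω
  · simp [h1, h1.trans h]
  · rw [if_neg h1]; split_ifs <;> simp [(hd A hA).le]

variable {V : Type*} [Fintype V] [DecidableEq V]

/-- The conditional expectation of `f`, under the weights `μ`, given the trace on `W`. -/
def ce (μ : Finset V → ℝ) (W : Finset V) (f : Finset V → ℝ) (ω : Finset V) : ℝ :=
  (∑ ω', if ω' ∩ W = ω ∩ W then μ ω' * f ω' else 0) /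
    ∑ ω', if ω' ∩ W = ω ∩ W then μ ω' else 0

lemma ce_congr (μ : Finset V → ℝ) {W : Finset V} (f : Finset V → ℝ) {ω ω' : Finset V}
    (h : ω' ∩ W = ω ∩ W) : ce μ W f ω' = ce μ W f ω := by
  unfold ce; rw [h]

/-- The defining property of the conditional expectation. -/
lemma sum_mul_ce {μ : Finset V → ℝ} (hμ : ∀ ω, 0 ≤ μ ω) {W : Finset V} (f : Finset V → ℝ)
    {h : Finset V → ℝ} (hh : ∀ ω ω', ω' ∩ W = ω ∩ W → h ω' = h ω) :
    ∑ ω, μ ω * (h ω * ce μ W f ω) = ∑ ω, μ ω * (h ω * f ω) := by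
  set N : Finset V → ℝ := fun ω => ∑ ω', if ω' ∩ W = ω ∩ W then μ ω' else 0 with hN
  have hNc : ∀ ω ω', ω' ∩ W = ω ∩ W → N ω' = N ω := by
    intro ω ω' e; simp only [hN, e]
  calc ∑ ω, μ ω * (h ω * ce μ W f ω)
      = ∑ ω, ∑ ω', if ω' ∩ W = ω ∩ W then μ ω * h ω * (μ ω' * f ω') / N ω else 0 := by
        refine Finset.sum_congr rfl fun ω _ => ?_
        unfold ce
        rw [Finset.sum_div, Finset.mul_sum, Finset.mul_sum]
        refine Finset.sum_congr rfl fun ω' _ => ?_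
        split_ifs
        · simp only [hN]; ring
        · simp
    _ = ∑ ω', ∑ ω, if ω' ∩ W = ω ∩ W then μ ω * h ω * (μ ω' * f ω') / N ω else 0 :=
        Finset.sum_comm
    _ = ∑ ω', (μ ω' * (h ω' * f ω')) / N ω' * N ω' := by
        refine Finset.sum_congr rfl fun ω' _ => ?_
        conv_rhs => rw [show N ω' = ∑ ω, if ω ∩ W = ω' ∩ W then μ ω else 0 from rfl]
        rw [Finset.mul_sum]
        refine Finset.sum_congr rfl fun ω _ => ?_
        by_cases e : ω' ∩ W = ω ∩ W
        · rw [if_pos e, if_pos e.symm, ← hNc ω ω' e, ← hh ω ω' e]; ring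
        · rw [if_neg e, if_neg (Ne.symm e), mul_zero]
    _ = _ := by
        refine Finset.sum_congr rfl fun ω _ => ?_
        by_cases h0 : N ω = 0
        · have : μ ω = 0 := by
            refine le_antisymm ?_ (hμ ω)
            rw [← h0]
            have := Finset.single_le_sum (f := fun ω' => if ω' ∩ W = ω ∩ W then μ ω' else 0)
              (fun i _ => by split_ifs <;> simp [hμ]) (Finset.mem_univ ω)
            simpa using this
          simp [this]
        · field_simp

/-- Conditioning on more vertices increases the energy by the mean squared increment. -/
lemma sum_sq_ce_sub {μ : Finset V → ℝ} (hμ : ∀ ω, 0 ≤ μ ω) (W S : Finset V)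
    (f : Finset V → ℝ) :
    ∑ ω, μ ω * (ce μ (W ∪ S) f ω - ce μ W f ω) ^ 2 =
      ∑ ω, μ ω * ce μ (W ∪ S) f ω ^ 2 - ∑ ω, μ ω * ce μ W f ω ^ 2 := by
  have hm : ∀ ω ω' : Finset V, ω' ∩ (W ∪ S) = ω ∩ (W ∪ S) → ω' ∩ W = ω ∩ W := by
    intro ω ω' h
    have := congrArg (· ∩ W) h
    simpa [Finset.inter_assoc, Finset.union_inter_cancel_left] using this
  have h1 := sum_mul_ce hμ f (W := W ∪ S) (h := ce μ W f)
    (fun ω ω' h => ce_congr μ f (hm ω ω' h))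
  have h2 := sum_mul_ce hμ f (W := W) (h := ce μ W f) (fun ω ω' h => ce_congr μ f h)
  rw [← h2] at h1
  have : ∀ ω, μ ω * (ce μ (W ∪ S) f ω - ce μ W f ω) ^ 2 =
      μ ω * ce μ (W ∪ S) f ω ^ 2 - 2 * (μ ω * (ce μ W f ω * ce μ (W ∪ S) f ω))
        + μ ω * (ce μ W f ω * ce μ W f ω) := fun ω => by ring
  simp only [this, Finset.sum_add_distrib, Finset.sum_sub_distrib, ← Finset.mul_sum]
  rw [h1]
  simp only [pow_two]
  ring

/-- The weights `μ` satisfy the upper correlation bound `E[Y_B ∣ Y_W] ≤ p^{|B|}`. -/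
def CondBounded (p : ℝ) (μ : Finset V → ℝ) : Prop :=
  ∀ B W σ : Finset V, Disjoint B W →
    (∑ ω, if B ⊆ ω ∧ ω ∩ W = σ then μ ω else 0) ≤
      p ^ B.card * ∑ ω, if ω ∩ W = σ then μ ω else 0

lemma ce_inc (μ : Finset V → ℝ) (W B ω : Finset V) :
    ce μ W (inc B) ω = (∑ ω', if B ⊆ ω' ∧ ω' ∩ W = ω ∩ W then μ ω' else 0) /
      ∑ ω', if ω' ∩ W = ω ∩ W then μ ω' else 0 := by
  unfold ce inc
  congr 1
  refine Finset.sum_congr rfl fun ω' _ => ?_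
  by_cases h1 : B ⊆ ω' <;> by_cases h2 : ω' ∩ W = ω ∩ W <;> simp [h1, h2]

lemma ce_inc_nonneg {μ : Finset V → ℝ} (hμ : ∀ ω, 0 ≤ μ ω) (W B ω : Finset V) :
    0 ≤ ce μ W (inc B) ω := by
  rw [ce_inc]
  exact div_nonneg (sum_ite_nonneg hμ _) (sum_ite_nonneg hμ _)

lemma ce_inc_le {p : ℝ} (hp : 0 ≤ p) {μ : Finset V → ℝ} (hμ : ∀ ω, 0 ≤ μ ω)
    (hb : CondBounded p μ) {W B : Finset V} (h : Disjoint B W) (ω : Finset V) :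
    ce μ W (inc B) ω ≤ p ^ B.card := by
  rw [ce_inc]
  exact div_le_of_le_mul₀ (sum_ite_nonneg hμ _) (pow_nonneg hp _) (hb B W _ h)

/-- The normalised defect of independence between `Y_b` and `Y_{B∖{b}}` given `Y_W`. -/
def defect (p : ℝ) (μ : Finset V → ℝ) (W B : Finset V) (b : V) (ω : Finset V) : ℝ :=
  (ce μ W (inc B) ω - ce μ W (inc (B.erase b)) ω * ce μ W (inc {b}) ω) / p ^ B.card

lemma defect_congr (p : ℝ) (μ : Finset V → ℝ) {W : Finset V} (B : Finset V) (b : V)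
    {ω ω' : Finset V} (h : ω' ∩ W = ω ∩ W) : defect p μ W B b ω' = defect p μ W B b ω := by
  unfold defect
  rw [ce_congr μ _ h, ce_congr μ _ h, ce_congr μ _ h]

lemma abs_defect_le {p : ℝ} (hp : 0 < p) {μ : Finset V → ℝ} (hμ : ∀ ω, 0 ≤ μ ω)
    (hb : CondBounded p μ) {W B : Finset V} {b : V} (hbB : b ∈ B) (h : Disjoint B W)
    (ω : Finset V) : |defect p μ W B b ω| ≤ 1 := by
  unfold defect
  rw [abs_div, abs_of_pos (pow_pos hp _), div_le_one (pow_pos hp _), abs_le]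
  have h1 := ce_inc_le hp.le hμ hb h ω
  have h2 := ce_inc_le hp.le hμ hb (h.mono_left (B.erase_subset b)) ω
  have h3 := ce_inc_le hp.le hμ hb
    (h.mono_left (Finset.singleton_subset_iff.2 hbB)) ω
  have n1 := ce_inc_nonneg hμ W B ω
  have n2 := ce_inc_nonneg hμ W (B.erase b) ω
  have n3 := ce_inc_nonneg hμ W {b} ω
  have e : p ^ B.card = p ^ (B.erase b).card * p ^ ({b} : Finset V).card := by
    rw [← pow_add, Finset.card_singleton, Finset.card_erase_add_one hbB]
  have h4 := mul_le_mul h2 h3 n3 (pow_nonneg hp.le _)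
  rw [← e] at h4
  have := mul_nonneg n2 n3
  constructor <;> linarith

/-- Testing the increment `E[Y_b ∣ Y_{W ∪ S}] - E[Y_b ∣ Y_W]` against the defect times
`Y_{B∖{b}}`, where `B∖{b} ⊆ S`, recovers the mean square of the defect. -/
lemma sum_increment_mul_defect {p : ℝ} (hp : 0 < p) {μ : Finset V → ℝ} (hμ : ∀ ω, 0 ≤ μ ω)
    {W S B : Finset V} {b : V} (hbB : b ∈ B) (hS : B.erase b ⊆ S) :
    ∑ ω, μ ω * ((defect p μ W B b ω * inc (B.erase b) ω) *
        (ce μ (W ∪ S) (inc {b}) ω - ce μ W (inc {b}) ω)) =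
      p ^ B.card * ∑ ω, μ ω * defect p μ W B b ω ^ 2 := by
  have hW : ∀ ω ω' : Finset V, ω' ∩ (W ∪ S) = ω ∩ (W ∪ S) → ω' ∩ W = ω ∩ W := by
    intro ω ω' h
    have := congrArg (· ∩ W) h
    simpa [Finset.inter_assoc, Finset.union_inter_cancel_left] using this
  have hU : ∀ ω ω' : Finset V, ω' ∩ (W ∪ S) = ω ∩ (W ∪ S) →
      inc (B.erase b) ω' = inc (B.erase b) ω := by
    intro ω ω' h
    have hx : ∀ x ∈ B.erase b, x ∈ ω' ↔ x ∈ ω := by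
      intro x hx
      have := Finset.ext_iff.1 h x
      simpa [hS hx] using this
    unfold inc
    congr 1
    exact propext ⟨fun k x hxB => (hx x hxB).1 (k hxB), fun k x hxB => (hx x hxB).2 (k hxB)⟩
  have e1 := sum_mul_ce hμ (inc {b}) (W := W ∪ S)
    (h := fun ω => defect p μ W B b ω * inc (B.erase b) ω)
    (fun ω ω' h => by rw [defect_congr p μ B b (hW ω ω' h), hU ω ω' h])
  have e2 := sum_mul_ce hμ (inc B) (W := W) (h := fun ω => defect p μ W B b ω)
    (fun ω ω' h => defect_congr p μ B b h)
  have e3 := sum_mul_ce hμ (inc (B.erase b)) (W := W)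
    (h := fun ω => defect p μ W B b ω * ce μ W (inc {b}) ω)
    (fun ω ω' h => by rw [defect_congr p μ B b h, ce_congr μ _ h])
  have hi : ∀ ω, inc (B.erase b) ω * inc {b} ω = inc B ω := fun ω => by
    rw [inc_mul_inc]; congr 1; ext x; by_cases x = b <;> simp_all
  have e1' : ∑ ω, μ ω * (defect p μ W B b ω * inc (B.erase b) ω * inc {b} ω) =
      ∑ ω, μ ω * (defect p μ W B b ω * inc B ω) :=
    Finset.sum_congr rfl fun ω _ => by rw [mul_assoc (defect p μ W B b ω), hi]
  have : ∀ ω, p ^ B.card * (μ ω * defect p μ W B b ω ^ 2) =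
      μ ω * (defect p μ W B b ω * ce μ W (inc B) ω) -
      μ ω * (defect p μ W B b ω * ce μ W (inc {b}) ω * ce μ W (inc (B.erase b)) ω) := by
    intro ω
    have : p ^ B.card * defect p μ W B b ω = ce μ W (inc B) ω -
        ce μ W (inc (B.erase b)) ω * ce μ W (inc {b}) ω := by
      unfold defect; field_simp
    calc _ = μ ω * defect p μ W B b ω * (p ^ B.card * defect p μ W B b ω) := by ring
      _ = _ := by rw [this]; ring
  rw [Finset.mul_sum]
  simp only [this, Finset.sum_sub_distrib, mul_sub]
  rw [e1, e1', e2, e3]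
  congr 1
  exact Finset.sum_congr rfl fun ω _ => by ring


lemma pw_nonneg {q : V → ℝ} (h0 : ∀ v, 0 ≤ q v) (h1 : ∀ v, q v ≤ 1) (ω : Finset V) :
    0 ≤ pw q ω :=
  mul_nonneg (Finset.prod_nonneg fun v _ => h0 v)
    (Finset.prod_nonneg fun v _ => sub_nonneg.2 (h1 v))

/-- The probability that a binomial random set contains `U` and avoids `F`. -/
lemma sum_pw_subset_disjoint (l : ℝ) {U F : Finset V} (h : Disjoint U F) :
    ∑ S, pw (fun _ : V => l) S * (if U ⊆ S ∧ Disjoint F S then 1 else 0) =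
      l ^ U.card * (1 - l) ^ F.card := by
  have key := Finset.prod_add (fun i => if i ∉ F then l else 0)
    (fun i => if i ∉ U then 1 - l else 0) (Finset.univ : Finset V)
  have hl : ∏ i : V, ((if i ∉ F then l else 0) + (if i ∉ U then 1 - l else 0)) =
      l ^ U.card * (1 - l) ^ F.card := by
    have : ∀ i : V, ((if i ∉ F then l else 0) + (if i ∉ U then 1 - l else 0)) =
        (if i ∈ U then l else 1) * (if i ∈ F then 1 - l else 1) := by
      intro i
      by_cases hU : i ∈ U
      · simp [hU, Finset.disjoint_left.1 h hU]
      · by_cases hF : i ∈ F <;> simp [hU, hF]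
    rw [Finset.prod_congr rfl fun i _ => this i, Finset.prod_mul_distrib]
    simp [Finset.prod_ite_mem]
  rw [← hl, key, Finset.powerset_univ]
  refine Finset.sum_congr rfl fun S _ => ?_
  rw [Finset.prod_ite_zero, Finset.prod_ite_zero]
  have a1 : (∀ i ∈ S, i ∉ F) ↔ Disjoint F S := Finset.disjoint_right.symm
  have a2 : (∀ i ∈ Finset.univ \ S, i ∉ U) ↔ U ⊆ S := by
    constructor
    · intro k x hx
      by_contra hxS
      exact k x (by simp [hxS]) hx
    · intro k x hx hxU
      simp [k hxU] at hx
  simp only [a1, a2]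
  unfold pw
  by_cases c1 : U ⊆ S <;> by_cases c2 : Disjoint F S <;>
    simp [c1, c2, Finset.compl_eq_univ_sdiff]

lemma sum_pw_mul_inc (l : ℝ) (U : Finset V) :
    ∑ S, pw (fun _ : V => l) S * inc U S = l ^ U.card := by
  simpa [inc] using sum_pw_subset_disjoint l (Finset.disjoint_empty_right U)

lemma sum_pw_mul_card (l : ℝ) :
    ∑ S, pw (fun _ : V => l) S * (S.card : ℝ) = l * Fintype.card V := by
  have h : ∀ S : Finset V, (S.card : ℝ) = ∑ v : V, inc {v} S := by
    intro S; simp [inc]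
  simp only [h, Finset.mul_sum]
  rw [Finset.sum_comm]
  simp only [sum_pw_mul_inc]
  simp [mul_comm]

/-- The pairs `(A, B)` of an edge `A` avoiding `W` and a subset `B ⊆ A` of size at least two
containing `b`. -/
def flags (H : Finset (Finset V)) (W : Finset V) (b : V) : Finset (Finset V × Finset V) :=
  (H ×ˢ Finset.univ).filter fun x =>
    Disjoint x.1 W ∧ x.2 ⊆ x.1 ∧ 2 ≤ x.2.card ∧ b ∈ x.2

lemma mem_flags {H : Finset (Finset V)} {W : Finset V} {b : V} {x : Finset V × Finset V} :
    x ∈ flags H W b ↔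
      x.1 ∈ H ∧ Disjoint x.1 W ∧ x.2 ⊆ x.1 ∧ 2 ≤ x.2.card ∧ b ∈ x.2 := by
  simp [flags]

lemma sum_flags_le {H : Finset (Finset V)} {d : Finset V → ℝ} {r : ℕ}
    (hr : ∀ A ∈ H, A.card = r) (hd : ∀ A ∈ H, 0 < d A) (W : Finset V) (b : V)
    (T : Finset V) :
    ∑ x ∈ flags H W b, (if T ⊆ x.2.erase b then d x.1 else 0) ≤
      2 ^ r * degH H d (insert b T) := by
  unfold flags degH
  rw [Finset.sum_filter, Finset.sum_product, Finset.mul_sum]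
  refine Finset.sum_le_sum fun A hA => ?_
  have hdA := (hd A hA).le
  calc _ ≤ ∑ B : Finset V,
        if B ∈ A.powerset then (if insert b T ⊆ A then d A else 0) else 0 := by
        refine Finset.sum_le_sum fun B _ => ?_
        by_cases h1 : Disjoint A W ∧ B ⊆ A ∧ 2 ≤ B.card ∧ b ∈ B
        · have hBA := h1.2.1
          simp only [h1, and_self, if_true, Finset.mem_powerset]
          by_cases h2 : T ⊆ B.erase b
          · rw [if_pos h2, if_pos]
            exact Finset.insert_subset (hBA h1.2.2.2)
              (h2.trans ((B.erase_subset b).trans hBA))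
          · rw [if_neg h2]; split_ifs <;> simp [hdA]
        · rw [if_neg h1]; split_ifs <;> simp [hdA]
    _ = _ := by
        rw [Finset.sum_ite_mem, Finset.univ_inter, Finset.sum_const, Finset.card_powerset,
          hr A hA]
        simp

/-- The Janson-type sum over pairs of flags at `b` is controlled by the degrees. -/
lemma sum_flags_mul_le {H : Finset (Finset V)} {d : Finset V → ℝ} {r : ℕ}
    (hr : ∀ A ∈ H, A.card = r) (hd : ∀ A ∈ H, 0 < d A) {q M : ℝ} (hq : 0 < q)
    (hM : 0 ≤ M)
    (hdeg : ∀ B : Finset V, 1 ≤ B.card → B.card ≤ r →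
      degH H d B ≤ M * q ^ (B.card - 1))
    (W : Finset V) (b : V) :
    ∑ x ∈ flags H W b, ∑ y ∈ flags H W b,
      d x.1 * d y.1 * (q ^ (x.2.erase b ∩ y.2.erase b).card)⁻¹ ≤ 8 ^ r * M ^ 2 := by
  have hT : ∀ x ∈ flags H W b, ∀ T ⊆ x.2.erase b,
      ∑ y ∈ flags H W b, (if T ⊆ y.2.erase b then d y.1 else 0) ≤
        2 ^ r * (M * q ^ T.card) := by
    intro x hx T hT
    obtain ⟨hA, -, hBA, -, hbB⟩ := mem_flags.1 hx
    have hbT : b ∉ T := fun h => Finset.notMem_erase b _ (hT h)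
    have hc : (insert b T).card = T.card + 1 := Finset.card_insert_of_notMem hbT
    have hle : (insert b T).card ≤ r := by
      rw [← hr _ hA]
      exact Finset.card_le_card (Finset.insert_subset (hBA hbB)
        (hT.trans ((Finset.erase_subset _ _).trans hBA)))
    refine (sum_flags_le hr hd W b T).trans ?_
    have := hdeg (insert b T) (by omega) hle
    rw [hc, Nat.add_sub_cancel] at this
    gcongr
  have hcard : ∀ x ∈ flags H W b, (x.2.erase b).card ≤ r := by
    intro x hx
    obtain ⟨hA, -, hBA, -, -⟩ := mem_flags.1 hx
    rw [← hr _ hA]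
    exact Finset.card_le_card ((Finset.erase_subset _ _).trans hBA)
  have hdx : ∀ x ∈ flags H W b, 0 ≤ d x.1 := fun x hx => (hd _ (mem_flags.1 hx).1).le
  have inner : ∀ x ∈ flags H W b, ∑ y ∈ flags H W b,
      d y.1 * (q ^ (x.2.erase b ∩ y.2.erase b).card)⁻¹ ≤ 4 ^ r * M := by
    intro x hx
    calc _ ≤ ∑ y ∈ flags H W b, ∑ T ∈ (x.2.erase b).powerset,
          (q ^ T.card)⁻¹ * (if T ⊆ y.2.erase b then d y.1 else 0) := by
          refine Finset.sum_le_sum fun y hy => ?_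
          have := Finset.single_le_sum
            (f := fun T => (q ^ T.card)⁻¹ * (if T ⊆ y.2.erase b then d y.1 else 0))
            (s := (x.2.erase b).powerset) (fun T _ => by
              refine mul_nonneg (inv_nonneg.2 (pow_nonneg hq.le _)) ?_
              split_ifs <;> simp [hdx y hy])
            (Finset.mem_powerset.2
              (Finset.inter_subset_left (s₁ := x.2.erase b) (s₂ := y.2.erase b)))
          simp only [if_pos (Finset.inter_subset_right
            (s₁ := x.2.erase b) (s₂ := y.2.erase b))] at this
          rw [mul_comm]
          exact this
      _ = ∑ T ∈ (x.2.erase b).powerset, (q ^ T.card)⁻¹ *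
            ∑ y ∈ flags H W b, (if T ⊆ y.2.erase b then d y.1 else 0) := by
          rw [Finset.sum_comm]
          simp only [Finset.mul_sum]
      _ ≤ ∑ T ∈ (x.2.erase b).powerset, 2 ^ r * M := by
          refine Finset.sum_le_sum fun T hTx => ?_
          have h := hT x hx T (Finset.mem_powerset.1 hTx)
          have hqT := pow_pos hq T.card
          rw [inv_mul_le_iff₀ hqT]
          linarith
      _ = 2 ^ (x.2.erase b).card * (2 ^ r * M) := by
          rw [Finset.sum_const, Finset.card_powerset]; simp
      _ ≤ 2 ^ r * (2 ^ r * M) := by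
          gcongr
          · norm_num
          · exact hcard x hx
      _ = 4 ^ r * M := by
          rw [← mul_assoc, ← mul_pow]; norm_num
  have houter : ∑ x ∈ flags H W b, d x.1 ≤ 2 ^ r * M := by
    rcases (flags H W b).eq_empty_or_nonempty with h | ⟨x, hx⟩
    · rw [h]; simp; positivity
    · simpa using hT x hx ∅ (by simp)
  calc _ = ∑ x ∈ flags H W b, d x.1 * ∑ y ∈ flags H W b,
          d y.1 * (q ^ (x.2.erase b ∩ y.2.erase b).card)⁻¹ := by
        simp only [Finset.mul_sum, mul_assoc]
    _ ≤ ∑ x ∈ flags H W b, d x.1 * (4 ^ r * M) :=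
        Finset.sum_le_sum fun x hx => mul_le_mul_of_nonneg_left (inner x hx) (hdx x hx)
    _ ≤ (2 ^ r * M) * (4 ^ r * M) := by
        rw [← Finset.sum_mul]; gcongr
    _ = 8 ^ r * M ^ 2 := by
        rw [show (8 : ℝ) = 2 * 4 by norm_num, mul_pow]; ring

/-- The test function at `b` built from the flags whose remaining part is contained in `S`. -/
def testFn (H : Finset (Finset V)) (d : Finset V → ℝ) (l p : ℝ) (μ : Finset V → ℝ)
    (W : Finset V) (b : V) (S ω : Finset V) : ℝ :=
  ∑ x ∈ flags H W b, d x.1 * ((l * p) ^ (x.2.erase b).card)⁻¹ * inc (x.2.erase b) S *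
    (defect p μ W x.2 b ω * inc (x.2.erase b) ω)

lemma sum_mul_testFn {H : Finset (Finset V)} {d : Finset V → ℝ} {l p : ℝ} (hp : 0 < p)
    (hl : 0 < l) {μ : Finset V → ℝ} (hμ : ∀ ω, 0 ≤ μ ω) (W : Finset V) (b : V) :
    ∑ S, pw (fun _ : V => l) S * (if b ∉ S then ∑ ω, μ ω * (testFn H d l p μ W b S ω *
        (ce μ (W ∪ S) (inc {b}) ω - ce μ W (inc {b}) ω)) else 0) =
      (1 - l) * p * ∑ x ∈ flags H W b, d x.1 * ∑ ω, μ ω * defect p μ W x.2 b ω ^ 2 := by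
  have h1 : ∀ S, ∑ ω, μ ω * (testFn H d l p μ W b S ω *
        (ce μ (W ∪ S) (inc {b}) ω - ce μ W (inc {b}) ω)) =
      ∑ x ∈ flags H W b, d x.1 * ((l * p) ^ (x.2.erase b).card)⁻¹ * inc (x.2.erase b) S *
        (p ^ x.2.card * ∑ ω, μ ω * defect p μ W x.2 b ω ^ 2) := by
    intro S
    unfold testFn
    simp only [Finset.sum_mul]
    simp only [Finset.mul_sum (s := flags H W b)]
    rw [Finset.sum_comm]
    refine Finset.sum_congr rfl fun x hx => ?_
    obtain ⟨-, -, -, -, hbB⟩ := mem_flags.1 hx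
    by_cases hS : x.2.erase b ⊆ S
    · rw [← sum_increment_mul_defect hp hμ hbB hS, Finset.mul_sum]
      exact Finset.sum_congr rfl fun ω _ => by ring
    · simp [inc, hS]
  have h2 : ∀ S, pw (fun _ : V => l) S * (if b ∉ S then ∑ ω, μ ω *
        (testFn H d l p μ W b S ω *
        (ce μ (W ∪ S) (inc {b}) ω - ce μ W (inc {b}) ω)) else 0) =
      ∑ x ∈ flags H W b, d x.1 * ((l * p) ^ (x.2.erase b).card)⁻¹ *
        (p ^ x.2.card * ∑ ω, μ ω * defect p μ W x.2 b ω ^ 2) *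
        (pw (fun _ : V => l) S *
          (if x.2.erase b ⊆ S ∧ Disjoint {b} S then 1 else 0)) := by
    intro S
    rw [h1]
    by_cases hb : b ∈ S
    · simp [hb]
    · simp only [hb, not_false_eq_true, if_true, Finset.mul_sum (s := flags H W b),
        Finset.disjoint_singleton_left, and_true, inc]
      exact Finset.sum_congr rfl fun x _ => by ring
  simp only [h2]
  rw [Finset.sum_comm, Finset.mul_sum]
  refine Finset.sum_congr rfl fun x hx => ?_
  obtain ⟨-, -, -, -, hbB⟩ := mem_flags.1 hx
  rw [← Finset.mul_sum, sum_pw_subset_disjoint l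
    (Finset.disjoint_singleton_right.2 (Finset.notMem_erase b _)), Finset.card_singleton,
    ← Finset.card_erase_add_one hbB, mul_pow, pow_succ]
  field_simp

lemma sum_sq_testFn_le {H : Finset (Finset V)} {d : Finset V → ℝ} {r : ℕ}
    (hr : ∀ A ∈ H, A.card = r) (hd : ∀ A ∈ H, 0 < d A) {l p M : ℝ} (hp : 0 < p)
    (hl : 0 < l) (hM : 0 ≤ M)
    (hdeg : ∀ B : Finset V, 1 ≤ B.card → B.card ≤ r →
      degH H d B ≤ M * (l * p) ^ (B.card - 1))
    {μ : Finset V → ℝ} (hμ : ∀ ω, 0 ≤ μ ω) (hμ1 : ∑ ω, μ ω = 1) (hb : CondBounded p μ)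
    (W : Finset V) (b : V) :
    ∑ S, pw (fun _ : V => l) S * ∑ ω, μ ω * testFn H d l p μ W b S ω ^ 2 ≤
      8 ^ r * M ^ 2 := by
  refine le_trans ?_ (sum_flags_mul_le hr hd (mul_pos hl hp) hM hdeg W b)
  set U : Finset V × Finset V → Finset V := fun x => x.2.erase b with hU
  set c : Finset V × Finset V → ℝ := fun x => d x.1 * ((l * p) ^ (U x).card)⁻¹ with hc
  set δ : Finset V × Finset V → Finset V → ℝ := fun x => defect p μ W x.2 b with hδ
  have expand : ∀ S ω, testFn H d l p μ W b S ω ^ 2 =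
      ∑ x ∈ flags H W b, ∑ y ∈ flags H W b, c x * c y * inc (U x ∪ U y) S *
        (δ x ω * δ y ω * inc (U x ∪ U y) ω) := by
    intro S ω
    unfold testFn
    rw [pow_two, Finset.sum_mul_sum]
    refine Finset.sum_congr rfl fun x _ => Finset.sum_congr rfl fun y _ => ?_
    rw [← inc_mul_inc, ← inc_mul_inc]
    simp only [hc, hδ, hU]
    ring
  have swap : ∑ S, pw (fun _ : V => l) S * ∑ ω, μ ω * testFn H d l p μ W b S ω ^ 2 =
      ∑ x ∈ flags H W b, ∑ y ∈ flags H W b, c x * c y * l ^ (U x ∪ U y).card *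
        ∑ ω, μ ω * (δ x ω * δ y ω * inc (U x ∪ U y) ω) := by
    have h1 : ∀ S, ∑ ω, μ ω * testFn H d l p μ W b S ω ^ 2 =
        ∑ x ∈ flags H W b, ∑ y ∈ flags H W b, c x * c y * inc (U x ∪ U y) S *
          ∑ ω, μ ω * (δ x ω * δ y ω * inc (U x ∪ U y) ω) := by
      intro S
      simp only [expand, Finset.mul_sum]
      rw [Finset.sum_comm]
      refine Finset.sum_congr rfl fun x _ => ?_
      rw [Finset.sum_comm]
      exact Finset.sum_congr rfl fun y _ => Finset.sum_congr rfl fun ω _ => by ring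
    simp only [h1, Finset.mul_sum (s := flags H W b)]
    rw [Finset.sum_comm]
    refine Finset.sum_congr rfl fun x _ => ?_
    rw [Finset.sum_comm]
    refine Finset.sum_congr rfl fun y _ => ?_
    generalize ∑ ω, μ ω * (δ x ω * δ y ω * inc (U x ∪ U y) ω) = E
    rw [← sum_pw_mul_inc l (U x ∪ U y), Finset.mul_sum, Finset.sum_mul]
    exact Finset.sum_congr rfl fun S _ => by ring
  rw [swap]
  refine Finset.sum_le_sum fun x hx => Finset.sum_le_sum fun y hy => ?_
  obtain ⟨hxH, hxW, hxs, -, hbx⟩ := mem_flags.1 hx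
  obtain ⟨hyH, hyW, hys, -, hby⟩ := mem_flags.1 hy
  have hdx := (hd _ hxH).le
  have hdy := (hd _ hyH).le
  have hE : ∑ ω, μ ω * (δ x ω * δ y ω * inc (U x ∪ U y) ω) ≤ p ^ (U x ∪ U y).card := by
    have h0 := hb (U x ∪ U y) ∅ ∅ (Finset.disjoint_empty_right _)
    simp only [Finset.inter_empty, and_true, if_true, hμ1, mul_one] at h0
    refine le_trans (Finset.sum_le_sum fun ω _ => ?_) h0
    have h1 := abs_defect_le hp hμ hb hbx (hxW.mono_left hxs) ω
    have h2 := abs_defect_le hp hμ hb hby (hyW.mono_left hys) ω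
    have h3 : δ x ω * δ y ω ≤ 1 := by
      refine (le_abs_self _).trans ?_
      rw [abs_mul]
      exact mul_le_one₀ h1 (abs_nonneg _) h2
    unfold inc
    split_ifs
    · simpa using mul_le_mul_of_nonneg_left h3 (hμ ω)
    · simp
  have hlp : 0 < l * p := mul_pos hl hp
  have hcx : 0 ≤ c x := by positivity
  have hcy : 0 ≤ c y := by positivity
  calc _ ≤ c x * c y * l ^ (U x ∪ U y).card * p ^ (U x ∪ U y).card := by gcongr
    _ = _ := by
      have hu := Finset.card_union_add_card_inter (U x) (U y)
      have : (l * p) ^ (U x ∪ U y).card * (l * p) ^ (U x ∩ U y).card =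
          (l * p) ^ (U x).card * (l * p) ^ (U y).card := by rw [← pow_add, ← pow_add, hu]
      rw [mul_assoc, ← mul_pow]
      simp only [hc]
      field_simp
      linear_combination d x.1 * d y.1 * this

/-- The energy `∑_{v ∉ W} E[E[Y_v ∣ Y_W]²]`. -/
def energy (μ : Finset V → ℝ) (W : Finset V) : ℝ :=
  ∑ v ∈ Wᶜ, ∑ ω, μ ω * ce μ W (inc {v}) ω ^ 2

lemma sum_sq_ce_inc_le {p : ℝ} (hp : 0 ≤ p) {μ : Finset V → ℝ} (hμ : ∀ ω, 0 ≤ μ ω)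
    (hμ1 : ∑ ω, μ ω = 1) (hb : CondBounded p μ) {W : Finset V} {v : V} (hv : v ∉ W) :
    ∑ ω, μ ω * ce μ W (inc {v}) ω ^ 2 ≤ p ^ 2 := by
  rw [← one_mul (p ^ 2), ← hμ1, Finset.sum_mul]
  refine Finset.sum_le_sum fun ω _ => mul_le_mul_of_nonneg_left ?_ (hμ ω)
  have h := ce_inc_le hp hμ hb (Finset.disjoint_singleton_left.2 hv) ω
  rw [Finset.card_singleton, pow_one] at h
  exact pow_le_pow_left₀ (ce_inc_nonneg hμ _ _ _) h 2

lemma energy_nonneg {μ : Finset V → ℝ} (hμ : ∀ ω, 0 ≤ μ ω) (W : Finset V) :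
    0 ≤ energy μ W :=
  Finset.sum_nonneg fun _ _ => Finset.sum_nonneg fun ω _ => mul_nonneg (hμ ω) (sq_nonneg _)

lemma energy_le {p : ℝ} (hp : 0 ≤ p) {μ : Finset V → ℝ} (hμ : ∀ ω, 0 ≤ μ ω)
    (hμ1 : ∑ ω, μ ω = 1) (hb : CondBounded p μ) (W : Finset V) :
    energy μ W ≤ Fintype.card V * p ^ 2 := by
  calc energy μ W ≤ ∑ v ∈ Wᶜ, p ^ 2 := Finset.sum_le_sum fun v hv =>
        sum_sq_ce_inc_le hp hμ hμ1 hb (Finset.mem_compl.1 hv)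
    _ = (Wᶜ.card : ℝ) * p ^ 2 := by rw [Finset.sum_const, nsmul_eq_mul]
    _ ≤ _ := by
        gcongr
        exact Finset.card_le_univ _

lemma sum_increment_sq_le {p : ℝ} (hp : 0 ≤ p) {μ : Finset V → ℝ} (hμ : ∀ ω, 0 ≤ μ ω)
    (hμ1 : ∑ ω, μ ω = 1) (hb : CondBounded p μ) (W S : Finset V) :
    ∑ v ∈ (W ∪ S)ᶜ, ∑ ω, μ ω * (ce μ (W ∪ S) (inc {v}) ω - ce μ W (inc {v}) ω) ^ 2 ≤
      energy μ (W ∪ S) - energy μ W + S.card * p ^ 2 := by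
  have hW : Wᶜ = (W ∪ S)ᶜ ∪ S \ W := by
    ext x; simp only [Finset.mem_compl, Finset.mem_union, Finset.mem_sdiff]; tauto
  have hdisj : Disjoint (W ∪ S)ᶜ (S \ W) := by
    rw [Finset.disjoint_left]
    intro x; simp only [Finset.mem_compl, Finset.mem_union, Finset.mem_sdiff]; tauto
  have hsd : ∑ v ∈ S \ W, ∑ ω, μ ω * ce μ W (inc {v}) ω ^ 2 ≤ S.card * p ^ 2 := by
    calc _ ≤ ∑ v ∈ S \ W, p ^ 2 := Finset.sum_le_sum fun v hv =>
          sum_sq_ce_inc_le hp hμ hμ1 hb (Finset.mem_sdiff.1 hv).2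
      _ = ((S \ W).card : ℝ) * p ^ 2 := by rw [Finset.sum_const, nsmul_eq_mul]
      _ ≤ _ := by
          gcongr
          exact Finset.sdiff_subset
  simp only [sum_sq_ce_sub hμ, Finset.sum_sub_distrib]
  have : energy μ W = ∑ v ∈ (W ∪ S)ᶜ, ∑ ω, μ ω * ce μ W (inc {v}) ω ^ 2 +
      ∑ v ∈ S \ W, ∑ ω, μ ω * ce μ W (inc {v}) ω ^ 2 := by
    unfold energy
    rw [hW, Finset.sum_union hdisj]
  rw [this]
  unfold energy
  linarith

/-- There is a small set for which adding any further vertices gains little energy. -/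
lemma exists_energy_maximizer {p : ℝ} (hp : 0 < p) {μ : Finset V → ℝ} (hμ : ∀ ω, 0 ≤ μ ω)
    (hμ1 : ∑ ω, μ ω = 1) (hb : CondBounded p μ) {α : ℝ} (hα : 0 < α) :
    ∃ W : Finset V, (W.card : ℝ) ≤ α * Fintype.card V ∧
      ∀ S : Finset V, energy μ (W ∪ S) - energy μ W ≤ α⁻¹ * p ^ 2 * S.card := by
  obtain ⟨W, -, hW⟩ := Finset.exists_max_image (Finset.univ : Finset (Finset V))
    (fun W => energy μ W - α⁻¹ * p ^ 2 * W.card) Finset.univ_nonempty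
  have hp2 : 0 < p ^ 2 := by positivity
  refine ⟨W, ?_, fun S => ?_⟩
  · have h0 := hW ∅ (Finset.mem_univ _)
    have h1 := energy_le hp.le hμ hμ1 hb W
    have h2 := energy_nonneg hμ (∅ : Finset V)
    simp only [Finset.card_empty, Nat.cast_zero, mul_zero, sub_zero] at h0
    have h3 : α⁻¹ * W.card * p ^ 2 ≤ Fintype.card V * p ^ 2 := by linarith
    have h4 := le_of_mul_le_mul_right h3 hp2
    rwa [inv_mul_le_iff₀ hα] at h4
  · have h0 := hW (W ∪ S) (Finset.mem_univ _)
    have h1 : ((W ∪ S).card : ℝ) ≤ W.card + S.card := by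
      exact_mod_cast Finset.card_union_le W S
    have h2 : α⁻¹ * p ^ 2 * (W ∪ S).card ≤ α⁻¹ * p ^ 2 * (W.card + S.card) := by gcongr
    linarith

/-- Energy-increment bound: if adding further vertices to `W` gains little energy, then the
total mean squared defect over the flags of `H - W` is small. -/
lemma sum_flags_defect_le {H : Finset (Finset V)} {d : Finset V → ℝ} {r : ℕ}
    (hr : ∀ A ∈ H, A.card = r) (hd : ∀ A ∈ H, 0 < d A) {l p M γ c : ℝ} (hp : 0 < p)
    (hl : 0 < l) (hl1 : l ≤ 1) (hM : 0 ≤ M) (hc : 0 < c)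
    (hdeg : ∀ B : Finset V, 1 ≤ B.card → B.card ≤ r →
      degH H d B ≤ M * (l * p) ^ (B.card - 1))
    {μ : Finset V → ℝ} (hμ : ∀ ω, 0 ≤ μ ω) (hμ1 : ∑ ω, μ ω = 1) (hb : CondBounded p μ)
    {W : Finset V}
    (hW : ∀ S : Finset V, energy μ (W ∪ S) - energy μ W ≤ γ * p ^ 2 * S.card) :
    (1 - l) * p * ∑ b, ∑ x ∈ flags H W b, d x.1 * ∑ ω, μ ω * defect p μ W x.2 b ω ^ 2 ≤
      Fintype.card V * (c / 2 * ((γ + 1) * p ^ 2 * l) + 1 / (2 * c) * (8 ^ r * M ^ 2)) := by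
  have hpw : ∀ S, 0 ≤ pw (fun _ : V => l) S := pw_nonneg (fun _ => hl.le) fun _ => hl1
  set F : V → Finset V → ℝ := fun b S => ∑ ω, μ ω * testFn H d l p μ W b S ω ^ 2 with hF
  set G : V → Finset V → ℝ := fun b S =>
    ∑ ω, μ ω * (ce μ (W ∪ S) (inc {b}) ω - ce μ W (inc {b}) ω) ^ 2 with hG
  have hF0 : ∀ b S, 0 ≤ F b S := fun b S =>
    Finset.sum_nonneg fun ω _ => mul_nonneg (hμ ω) (sq_nonneg _)
  have hpair : ∀ b S, (if b ∉ S then ∑ ω, μ ω * (testFn H d l p μ W b S ω *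
        (ce μ (W ∪ S) (inc {b}) ω - ce μ W (inc {b}) ω)) else 0) ≤
      c / 2 * (if b ∈ (W ∪ S)ᶜ then G b S else 0) + 1 / (2 * c) * F b S := by
    intro b S
    have hF' : 0 ≤ 1 / (2 * c) * F b S := mul_nonneg (by positivity) (hF0 b S)
    by_cases hbS : b ∈ S
    · simpa [hbS] using hF'
    by_cases hbW : b ∈ W
    · have : flags H W b = ∅ := by
        rw [Finset.eq_empty_iff_forall_notMem]
        intro x hx
        obtain ⟨-, hxW, hxs, -, hbx⟩ := mem_flags.1 hx
        exact Finset.disjoint_left.1 hxW (hxs hbx) hbW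
      simpa [hbW, testFn, this] using hF'
    · rw [if_pos hbS, if_pos (by simp [hbS, hbW])]
      simp only [hF, hG, Finset.mul_sum]
      rw [← Finset.sum_add_distrib]
      refine Finset.sum_le_sum fun ω _ => ?_
      generalize testFn H d l p μ W b S ω = f
      generalize ce μ (W ∪ S) (inc {b}) ω - ce μ W (inc {b}) ω = g
      have : f * g ≤ c / 2 * g ^ 2 + 1 / (2 * c) * f ^ 2 := by
        have h : 0 ≤ (c * g - f) ^ 2 / (2 * c) := by positivity
        have e : (c * g - f) ^ 2 / (2 * c) = c / 2 * g ^ 2 + 1 / (2 * c) * f ^ 2 - f * g := by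
          field_simp; ring
        linarith
      calc _ ≤ μ ω * (c / 2 * g ^ 2 + 1 / (2 * c) * f ^ 2) :=
            mul_le_mul_of_nonneg_left this (hμ ω)
        _ = _ := by ring
  have hGsum : ∀ S, ∑ b, (if b ∈ (W ∪ S)ᶜ then G b S else 0) ≤
      (γ + 1) * p ^ 2 * S.card := by
    intro S
    rw [Finset.sum_ite_mem, Finset.univ_inter]
    have h1 := sum_increment_sq_le hp.le hμ hμ1 hb W S
    have h2 := hW S
    linarith
  have hFsum : ∀ b, ∑ S, pw (fun _ : V => l) S * F b S ≤ 8 ^ r * M ^ 2 := fun b =>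
    sum_sq_testFn_le hr hd hp hl hM hdeg hμ hμ1 hb W b
  rw [Finset.mul_sum]
  calc _ = ∑ b, ∑ S, pw (fun _ : V => l) S * (if b ∉ S then ∑ ω, μ ω *
          (testFn H d l p μ W b S ω *
            (ce μ (W ∪ S) (inc {b}) ω - ce μ W (inc {b}) ω)) else 0) :=
        Finset.sum_congr rfl fun b _ => (sum_mul_testFn hp hl hμ W b).symm
    _ ≤ ∑ b, ∑ S, pw (fun _ : V => l) S *
          (c / 2 * (if b ∈ (W ∪ S)ᶜ then G b S else 0) + 1 / (2 * c) * F b S) :=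
        Finset.sum_le_sum fun b _ => Finset.sum_le_sum fun S _ =>
          mul_le_mul_of_nonneg_left (hpair b S) (hpw S)
    _ = c / 2 * (∑ S, pw (fun _ : V => l) S *
            ∑ b, (if b ∈ (W ∪ S)ᶜ then G b S else 0)) +
          1 / (2 * c) * ∑ b, ∑ S, pw (fun _ : V => l) S * F b S := by
        simp only [mul_add, Finset.sum_add_distrib]
        congr 1
        · rw [Finset.sum_comm]
          simp only [Finset.mul_sum]
          exact Finset.sum_congr rfl fun S _ => Finset.sum_congr rfl fun b _ => by ring
        · simp only [Finset.mul_sum]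
          exact Finset.sum_congr rfl fun S _ => Finset.sum_congr rfl fun b _ => by ring
    _ ≤ c / 2 * (∑ S, pw (fun _ : V => l) S * ((γ + 1) * p ^ 2 * S.card)) +
          1 / (2 * c) * ∑ _b : V, 8 ^ r * M ^ 2 := by
        gcongr with S _ b _
        · exact hpw S
        · exact hGsum S
        · exact hFsum b
    _ = _ := by
        have : ∑ S, pw (fun _ : V => l) S * ((γ + 1) * p ^ 2 * S.card) =
            (γ + 1) * p ^ 2 * ∑ S, pw (fun _ : V => l) S * (S.card : ℝ) := by
          rw [Finset.mul_sum]
          exact Finset.sum_congr rfl fun S _ => by ring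
        rw [this, sum_pw_mul_card, Finset.sum_const, Finset.card_univ, nsmul_eq_mul]
        ring

/-- The distribution of the `p`-random set conditioned on the lower-tail event. -/
def lowerTail (H : Finset (Finset V)) (d : Finset V → ℝ) (r : ℕ) (p η : ℝ)
    (ω : Finset V) : ℝ :=
  (if eInd H d ω ≤ η * p ^ r * eTot H d then pw (fun _ => p) ω else 0) /
    ∑ ω : Finset V, if eInd H d ω ≤ η * p ^ r * eTot H d then pw (fun _ => p) ω else 0

lemma nuPr_eq_sum (H : Finset (Finset V)) (d : Finset V → ℝ) (r : ℕ) (p η : ℝ)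
    (P : Finset V → Prop) [DecidablePred P] :
    nuPr H d r p η P = ∑ ω, if P ω then lowerTail H d r p η ω else 0 := by
  unfold nuPr lowerTail
  rw [Finset.sum_div]
  refine Finset.sum_congr rfl fun ω _ => ?_
  by_cases h1 : P ω <;> simp [h1]

lemma condE_eq_ce (H : Finset (Finset V)) (d : Finset V → ℝ) (r : ℕ) (p η : ℝ)
    (W ω B : Finset V) :
    condE H d r p η W (ω ∩ W) B = ce (lowerTail H d r p η) W (inc B) ω := by
  unfold condE
  rw [nuPr_eq_sum, nuPr_eq_sum, ce_inc]

lemma lowerTail_nonneg (H : Finset (Finset V)) (d : Finset V → ℝ) (r : ℕ) {p : ℝ} (η : ℝ)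
    (hp : 0 ≤ p) (hp1 : p ≤ 1) (ω : Finset V) : 0 ≤ lowerTail H d r p η ω := by
  have h : ∀ ω : Finset V, 0 ≤ pw (fun _ => p) ω := pw_nonneg (fun _ => hp) fun _ => hp1
  exact div_nonneg (by split_ifs <;> simp [h])
    (Finset.sum_nonneg fun ω _ => by split_ifs <;> simp [h])

lemma sum_lowerTail {H : Finset (Finset V)} {d : Finset V → ℝ} {r : ℕ} (hr : 1 ≤ r)
    (hH : ∀ A ∈ H, A.card = r) (hd : ∀ A ∈ H, 0 < d A) {p η : ℝ}
    (hp : 0 < p) (hp1 : p < 1) (hη : 0 ≤ η) :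
    ∑ ω, lowerTail H d r p η ω = 1 := by
  unfold lowerTail
  rw [← Finset.sum_div]
  refine div_self (ne_of_gt ?_)
  have h : ∀ ω : Finset V, 0 ≤ pw (fun _ => p) ω :=
    pw_nonneg (fun _ => hp.le) fun _ => hp1.le
  refine Finset.sum_pos' (fun ω _ => by split_ifs <;> simp [h]) ⟨∅, Finset.mem_univ _, ?_⟩
  have he : eInd H d ∅ = 0 := by
    unfold eInd
    refine Finset.sum_eq_zero fun A hA => if_neg fun h => ?_
    have := hH A hA
    rw [Finset.subset_empty.1 h, Finset.card_empty] at this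
    omega
  have ht : 0 ≤ eTot H d := Finset.sum_nonneg fun A hA => (hd A hA).le
  rw [if_pos (by rw [he]; positivity)]
  unfold pw
  have : 0 < 1 - p := by linarith
  rw [Finset.prod_empty, one_mul, Finset.prod_const]
  positivity

lemma pw_insert (p : ℝ) {b : V} {ω : Finset V} (h : b ∉ ω) :
    (1 - p) * pw (fun _ => p) (insert b ω) = p * pw (fun _ => p) ω := by
  unfold pw
  rw [Finset.prod_insert h, ← Finset.mul_prod_erase ωᶜ _ (Finset.mem_compl.2 h),
    ← Finset.compl_insert]
  ring

/-- A one-vertex Harris inequality: restricting an event closed under deleting `b` to sets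
containing `b` costs a factor of at least `p`. -/
lemma sum_pw_mem_le {p : ℝ} (hp : 0 ≤ p) (hp1 : p ≤ 1) (b : V) (P : Finset V → Prop)
    [DecidablePred P] (hP : ∀ ω, b ∉ ω → P (insert b ω) → P ω) :
    (∑ ω, if b ∈ ω ∧ P ω then pw (fun _ : V => p) ω else 0) ≤
      p * ∑ ω, if P ω then pw (fun _ : V => p) ω else 0 := by
  have h0 : ∀ ω : Finset V, 0 ≤ pw (fun _ => p) ω := pw_nonneg (fun _ => hp) fun _ => hp1
  have split : ∀ f : Finset V → ℝ, ∑ ω, f ω =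
      ∑ ω ∈ (Finset.univ.erase b).powerset, f ω +
        ∑ ω ∈ (Finset.univ.erase b).powerset, f (insert b ω) := by
    intro f
    rw [← Finset.sum_powerset_insert (Finset.notMem_erase b _),
      Finset.insert_erase (Finset.mem_univ b), Finset.powerset_univ]
  rw [split, split (fun ω => if P ω then _ else _), ← Finset.sum_add_distrib,
    ← Finset.sum_add_distrib, Finset.mul_sum]
  refine Finset.sum_le_sum fun ω hω => ?_
  have hb : b ∉ ω := fun h => Finset.notMem_erase b _ (Finset.mem_powerset.1 hω h)
  have e := pw_insert p hb
  have n1 := h0 ω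
  have n2 := h0 (insert b ω)
  by_cases h1 : P (insert b ω)
  · have h2 := hP ω hb h1
    simp only [hb, h1, h2, false_and, Finset.mem_insert_self, if_true, if_false, true_and]
    linarith
  · simp only [hb, h1, false_and, and_false, if_false]
    split_ifs
    · rw [add_zero]
      positivity
    · simp

lemma condBounded_lowerTail {H : Finset (Finset V)} {d : Finset V → ℝ} (r : ℕ)
    (hd : ∀ A ∈ H, 0 < d A) {p : ℝ} (η : ℝ) (hp : 0 ≤ p) (hp1 : p ≤ 1) :
    CondBounded p (lowerTail H d r p η) := by
  intro B W σ hBW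
  have key : (∑ ω, if B ⊆ ω ∧ ω ∩ W = σ ∧ eInd H d ω ≤ η * p ^ r * eTot H d then
        pw (fun _ : V => p) ω else 0) ≤
      p ^ B.card * ∑ ω, if ω ∩ W = σ ∧ eInd H d ω ≤ η * p ^ r * eTot H d then
        pw (fun _ : V => p) ω else 0 := by
    induction B using Finset.induction_on with
    | empty => simp
    | insert b B hbB ih =>
      rw [Finset.disjoint_insert_left] at hBW
      have h := sum_pw_mem_le hp hp1 b
        (fun ω => B ⊆ ω ∧ ω ∩ W = σ ∧ eInd H d ω ≤ η * p ^ r * eTot H d)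
        (fun ω _ h => ⟨(Finset.subset_insert_iff_of_notMem hbB).1 h.1,
          by rw [← h.2.1, Finset.insert_inter_of_notMem hBW.1],
          (eInd_mono hd (Finset.subset_insert b ω)).trans h.2.2⟩)
      simp only [Finset.insert_subset_iff, and_assoc]
      refine h.trans ?_
      rw [Finset.card_insert_of_notMem hbB, pow_succ', mul_assoc p]
      exact mul_le_mul_of_nonneg_left (ih hBW.2) hp
  have h0 : ∀ ω : Finset V, 0 ≤ pw (fun _ => p) ω := pw_nonneg (fun _ => hp) fun _ => hp1
  have e : ∀ (P : Finset V → Prop) [DecidablePred P],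
      (∑ ω, if P ω then lowerTail H d r p η ω else 0) =
      (∑ ω, if P ω ∧ eInd H d ω ≤ η * p ^ r * eTot H d then pw (fun _ : V => p) ω else 0) /
        ∑ ω : Finset V,
          if eInd H d ω ≤ η * p ^ r * eTot H d then pw (fun _ => p) ω else 0 := by
    intro P _
    rw [Finset.sum_div]
    refine Finset.sum_congr rfl fun ω _ => ?_
    by_cases h1 : P ω <;> simp [h1, lowerTail]
  rw [e, e, ← mul_div_assoc]
  simp only [and_assoc]
  exact div_le_div_of_nonneg_right key
    (Finset.sum_nonneg fun ω _ => by split_ifs <;> simp [h0])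

lemma errW_le {H : Finset (Finset V)} {d : Finset V → ℝ} {r : ℕ}
    (hr : ∀ A ∈ H, A.card = r) (hd : ∀ A ∈ H, 0 < d A) {p : ℝ} (η : ℝ)
    (hp : 0 < p) (hp1 : p ≤ 1) (W : Finset V) :
    errW H d r p η W ≤ ∑ b, ∑ x ∈ flags H W b, d x.1 *
      ∑ ω, lowerTail H d r p η ω * defect p (lowerTail H d r p η) W x.2 b ω ^ 2 := by
  set μ := lowerTail H d r p η with hμdef
  have hμ : ∀ ω, 0 ≤ μ ω := lowerTail_nonneg H d r η hp.le hp1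
  have step : errW H d r p η W = ∑ ω, μ ω *
      ∑ A ∈ H.filter (fun A => Disjoint A W),
        ∑ B ∈ A.powerset.filter (fun B => 2 ≤ B.card), ∑ b ∈ B,
          d A * (DW H d r p η W (ω ∩ W) B b) ^ 2 /
            ((r.choose B.card : ℝ) * (B.card : ℝ) * p ^ (2 * B.card)) := by
    unfold errW
    simp only [nuPr_eq_sum, Finset.sum_mul]
    rw [Finset.sum_comm]
    refine Finset.sum_congr rfl fun ω _ => ?_
    rw [Finset.sum_eq_single (ω ∩ W)]
    · simp [hμdef]
    · intro s _ hs
      rw [if_neg (Ne.symm hs), zero_mul]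
    · intro h
      exact absurd (Finset.mem_powerset.2 Finset.inter_subset_right) h
  have bound : ∀ ω, (∑ A ∈ H.filter (fun A => Disjoint A W),
        ∑ B ∈ A.powerset.filter (fun B => 2 ≤ B.card), ∑ b ∈ B,
          d A * (DW H d r p η W (ω ∩ W) B b) ^ 2 /
            ((r.choose B.card : ℝ) * (B.card : ℝ) * p ^ (2 * B.card))) ≤
      ∑ b, ∑ x ∈ flags H W b, d x.1 * defect p μ W x.2 b ω ^ 2 := by
    intro ω
    calc _ ≤ ∑ A ∈ H.filter (fun A => Disjoint A W),
          ∑ B ∈ A.powerset.filter (fun B => 2 ≤ B.card), ∑ b ∈ B,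
            d A * defect p μ W B b ω ^ 2 := by
          refine Finset.sum_le_sum fun A hA => Finset.sum_le_sum fun B hB =>
            Finset.sum_le_sum fun b _ => ?_
          obtain ⟨hA, -⟩ := Finset.mem_filter.1 hA
          obtain ⟨hBA, hB2⟩ := Finset.mem_filter.1 hB
          have hBr : B.card ≤ r := hr A hA ▸ Finset.card_le_card (Finset.mem_powerset.1 hBA)
          have c1 : (1 : ℝ) ≤ r.choose B.card := by exact_mod_cast Nat.choose_pos hBr
          have c2 : (1 : ℝ) ≤ B.card := by exact_mod_cast (by omega : 1 ≤ B.card)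
          have hdA := (hd A hA).le
          have e : DW H d r p η W (ω ∩ W) B b = defect p μ W B b ω * p ^ B.card := by
            unfold DW defect
            rw [condE_eq_ce, condE_eq_ce, condE_eq_ce,
              div_mul_cancel₀ _ (pow_pos hp _).ne']
          have hpc : 0 < p ^ B.card := by positivity
          rw [e, mul_pow, ← pow_mul, mul_comm B.card 2]
          have hq : 0 < p ^ (2 * B.card) := by positivity
          rw [← mul_assoc, mul_div_mul_right _ _ hq.ne']
          exact div_le_self (by positivity) (one_le_mul_of_one_le_of_one_le c1 c2)
      _ = _ := by
          unfold flags
          simp only [Finset.sum_filter, Finset.sum_product]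
          rw [Finset.sum_comm (s := (Finset.univ : Finset V))]
          refine Finset.sum_congr rfl fun A _ => ?_
          rw [Finset.sum_comm (s := (Finset.univ : Finset V))]
          by_cases hAW : Disjoint A W
          · simp only [hAW, if_true, true_and]
            rw [← Finset.univ_inter A.powerset, ← Finset.sum_ite_mem]
            refine Finset.sum_congr rfl fun B _ => ?_
            by_cases h1 : B ⊆ A <;> by_cases h2 : 2 ≤ B.card <;> simp [h1, h2]
          · simp [hAW]
  rw [step]
  calc _ ≤ ∑ ω, μ ω * ∑ b, ∑ x ∈ flags H W b, d x.1 * defect p μ W x.2 b ω ^ 2 :=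
        Finset.sum_le_sum fun ω _ => mul_le_mul_of_nonneg_left (bound ω) (hμ ω)
    _ = _ := by
        simp only [Finset.mul_sum]
        rw [Finset.sum_comm]
        refine Finset.sum_congr rfl fun b _ => ?_
        rw [Finset.sum_comm]
        exact Finset.sum_congr rfl fun x _ => Finset.sum_congr rfl fun ω _ => by ring

end Conditioning

/-- Lemma `claim:main`: for all positive `α`, `β`, `K`, every integer `r ≥ 1` and every
`p₀ < 1`, there exist `λ > 0` and `V₀` such that the following holds.  If `(H, d)` is an
`r`-uniform weighted hypergraph on a finite set `V` with `|V| ≥ V₀` satisfying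
`Δ_s(H) ≤ K (λp)^{s−1} e(H)/v(H)` for all `s ∈ {1,…,r}`, where `p ∈ (0, p₀]`, and `Y` is
the indicator vector of the `p`-random subset `R` conditioned on `e(H[R]) ≤ η p^r e(H)`
(for some `η ≥ 0`), then there exists `W ⊆ V` with `|W| ≤ α|V|` and `𝓔(W) ≤ β e(H)`. -/
theorem exists_good_conditioning_set (r : ℕ) (hr : 1 ≤ r) (α β K p₀ : ℝ)
    (hα : 0 < α) (hβ : 0 < β) (hK : 0 < K) (hp₀ : p₀ < 1) :
    ∃ lam V₀ : ℝ, 0 < lam ∧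
      ∀ (V : Type) [Fintype V] [DecidableEq V]
        (H : Finset (Finset V)) (d : Finset V → ℝ),
        V₀ ≤ (Fintype.card V : ℝ) →
        (∀ A ∈ H, A.card = r) → (∀ A ∈ H, 0 < d A) →
        ∀ p : ℝ, 0 < p → p ≤ p₀ →
        (∀ s : ℕ, 1 ≤ s → s ≤ r → ∀ B : Finset V, B.card = s →
          degH H d B ≤ K * (lam * p) ^ (s - 1) * (eTot H d / (Fintype.card V : ℝ))) →
        ∀ η : ℝ, 0 ≤ η →
          ∃ W : Finset V, (W.card : ℝ) ≤ α * (Fintype.card V : ℝ) ∧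
            errW H d r p η W ≤ β * eTot H d := by
  set a : ℝ := 2 * 8 ^ r * K ^ 2 / β with ha
  have ha0 : 0 < a := by positivity
  have hγ : 0 < α⁻¹ + 1 := by positivity
  refine ⟨min (1 / 2) (β / (2 * a * (α⁻¹ + 1))), 0, by positivity, ?_⟩
  set l : ℝ := min (1 / 2) (β / (2 * a * (α⁻¹ + 1))) with hl
  have hl0 : 0 < l := by positivity
  have hl1 : l ≤ 1 / 2 := min_le_left _ _
  have hl2 : a * ((α⁻¹ + 1) * l) ≤ β / 2 := by
    have : l ≤ β / (2 * a * (α⁻¹ + 1)) := min_le_right _ _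
    rw [le_div_iff₀ (by positivity)] at this
    linarith
  intro V _ _ H d _ hH hd p hp hpp hdeg η hη
  have hp1 : p < 1 := lt_of_le_of_lt hpp hp₀
  rcases H.eq_empty_or_nonempty with rfl | hne
  · exact ⟨∅, by simp; positivity, by simp [errW, eTot]⟩
  have he : 0 < eTot H d := Finset.sum_pos hd hne
  have hn : 0 < (Fintype.card V : ℝ) := by
    obtain ⟨A, hA⟩ := hne
    have h1 := hH A hA
    have h2 := Finset.card_le_univ A
    exact_mod_cast (by omega : 0 < Fintype.card V)
  have hμ := lowerTail_nonneg H d r η hp.le hp1.le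
  have hμ1 := sum_lowerTail hr hH hd hp hp1 hη
  have hb := condBounded_lowerTail (H := H) r hd η hp.le hp1.le
  obtain ⟨W, hWc, hW⟩ := exists_energy_maximizer hp hμ hμ1 hb hα
  refine ⟨W, hWc, (errW_le hH hd η hp hp1.le W).trans ?_⟩
  set e := eTot H d with he_def
  set n : ℝ := (Fintype.card V : ℝ) with hn_def
  have main := sum_flags_defect_le (M := K * (e / n)) (c := a * e / (p * n)) hH hd hp hl0
    (by linarith) (by positivity) (by positivity)
    (fun B h1 h2 => (hdeg B.card h1 h2 B rfl).trans_eq (by ring)) hμ hμ1 hb hW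
  set X := ∑ b, ∑ x ∈ flags H W b, d x.1 *
    ∑ ω, lowerTail H d r p η ω * defect p (lowerTail H d r p η) W x.2 b ω ^ 2 with hX
  have hX0 : 0 ≤ X := Finset.sum_nonneg fun b _ => Finset.sum_nonneg fun x hx =>
    mul_nonneg (hd _ (mem_flags.1 hx).1).le
      (Finset.sum_nonneg fun ω _ => mul_nonneg (hμ ω) (sq_nonneg _))
  have hrhs : n * (a * e / (p * n) / 2 * ((α⁻¹ + 1) * p ^ 2 * l) +
      1 / (2 * (a * e / (p * n))) * (8 ^ r * (K * (e / n)) ^ 2)) =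
      p * e / 2 * (a * ((α⁻¹ + 1) * l) + 8 ^ r * K ^ 2 / a) := by
    field_simp
  have haβ : 8 ^ r * K ^ 2 / a = β / 2 := by
    rw [ha]; field_simp
  rw [hrhs, haβ] at main
  have h1 : 1 / 2 * p * X ≤ (1 - l) * p * X := by gcongr; linarith
  have h2 : p * e / 2 * (a * ((α⁻¹ + 1) * l) + β / 2) ≤ p * e / 2 * β := by
    gcongr; linarith
  have h3 : p / 2 * X ≤ p / 2 * (β * e) := by linarith
  exact le_of_mul_le_mul_left h3 (by positivity)

end
end

section
/- Let H be a weighted r-uniform hypergraph on a finite set V satisfying Δ_1(H) ≤ K·e(H)/v(H) for some K > 0. Then, for every p ∈ (0,1) and every ε ∈ (0,1], Φ_p^H(1−ε) ≥ (ε²/(2K²))·|V|·p. -/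
open Classical

noncomputable section

/-- `E[e(H[R^{(q)}])]`: the expected induced edge weight when each vertex `v` is retained
independently with probability `q v`. -/
def expE {V : Type*} [Fintype V] [DecidableEq V] (H : Finset (Finset V))
    (d : Finset V → ℝ) (q : V → ℝ) : ℝ :=
  ∑ ω : Finset V, pw q ω * eInd H d ω

/-- `Φ_p^H(η)`: the least relative entropy `∑_v i_p(q_v)` of a product measure under which
the expected induced edge weight is at most `η` times that of the `p`-random subset. -/
def PhiH {V : Type*} [Fintype V] [DecidableEq V] (H : Finset (Finset V))
    (d : Finset V → ℝ) (p η : ℝ) : ℝ :=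
  sInf {x | ∃ q : V → ℝ, (∀ v, q v ∈ Set.Icc (0 : ℝ) 1) ∧
    expE H d q ≤ η * expE H d (fun _ => p) ∧ x = ∑ v, ip p (q v)}

/-- The probability that the random set with inclusion probabilities `q` contains `A`. -/
lemma sum_pw_superset {V : Type*} [Fintype V] [DecidableEq V] (q : V → ℝ) (A : Finset V) :
    (∑ ω : Finset V, if A ⊆ ω then pw q ω else 0) = ∏ v ∈ A, q v := by
  have h := Fintype.prod_add q (fun v => if v ∈ A then 0 else 1 - q v)
  have hl : ∏ v, (q v + if v ∈ A then 0 else 1 - q v) = ∏ v ∈ A, q v := by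
    rw [← Finset.prod_subset (Finset.subset_univ A)]
    · exact Finset.prod_congr rfl fun v hv => by simp [hv]
    · intro v _ hv
      simp [hv]
  rw [← hl, h]
  refine Finset.sum_congr rfl fun ω _ => ?_
  split_ifs with hA
  · unfold pw
    congr 1
    refine Finset.prod_congr rfl fun v hv => ?_
    have : v ∉ A := fun hv' => Finset.mem_compl.1 hv (hA hv')
    simp [this]
  · obtain ⟨v, hvA, hvω⟩ := Finset.not_subset.1 hA
    rw [Finset.prod_eq_zero (i := v) (Finset.mem_compl.2 hvω) (by simp [hvA]), mul_zero]

lemma expE_eq_sum_prod {V : Type*} [Fintype V] [DecidableEq V] (H : Finset (Finset V))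
    (d : Finset V → ℝ) (q : V → ℝ) :
    expE H d q = ∑ A ∈ H, d A * ∏ v ∈ A, q v := by
  unfold expE eInd
  simp_rw [Finset.mul_sum]
  rw [Finset.sum_comm]
  refine Finset.sum_congr rfl fun A _ => ?_
  rw [← sum_pw_superset, Finset.mul_sum]
  exact Finset.sum_congr rfl fun ω _ => by split_ifs <;> ring

lemma one_sub_sum_le_prod_one_sub {ι : Type*} [DecidableEq ι] (s : Finset ι) (x : ι → ℝ)
    (h0 : ∀ i, 0 ≤ x i) (h1 : ∀ i, x i ≤ 1) :
    1 - ∑ i ∈ s, x i ≤ ∏ i ∈ s, (1 - x i) := by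
  induction s using Finset.induction_on with
  | empty => simp
  | insert a s ha ih =>
    rw [Finset.sum_insert ha, Finset.prod_insert ha]
    have hs : 0 ≤ ∑ i ∈ s, x i := Finset.sum_nonneg fun i _ => h0 i
    nlinarith [mul_le_mul_of_nonneg_left ih (sub_nonneg.2 (h1 a)), mul_nonneg (h0 a) hs]

/-- The tangent-line bound `x log (x / y) ≥ x - y`. -/
lemma sub_le_mul_log_div {x y : ℝ} (hx : 0 ≤ x) (hy : 0 < y) :
    x - y ≤ x * Real.log (x / y) := by
  rcases hx.eq_or_lt with rfl | hx
  · simpa using hy.le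
  · have h := mul_le_mul_of_nonneg_left (Real.one_sub_inv_le_log_of_pos (div_pos hx hy)) hx.le
    have : x * (1 - (x / y)⁻¹) = x - y := by field_simp
    linarith

lemma sub_add_sq_le_mul_log_div {x y : ℝ} (hx : 0 ≤ x) (hxy : x ≤ y) (hy : 0 < y) :
    x - y + (y - x) ^ 2 / (2 * y) ≤ x * Real.log (x / y) := by
  rcases hx.eq_or_lt with rfl | hx
  · have : 0 - y + (y - 0) ^ 2 / (2 * y) = -(y / 2) := by field_simp; ring
    rw [this]
    simpa using (half_pos hy).le
  · have hlog : 0 ≤ Real.log (y / x) := Real.log_nonneg ((one_le_div hx).2 hxy)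
    have hsinh := Real.self_le_sinh_iff.2 hlog
    rw [Real.sinh_log (div_pos hy hx)] at hsinh
    have h := mul_le_mul_of_nonneg_left hsinh hx.le
    have hinv : Real.log (x / y) = -Real.log (y / x) := by rw [← Real.log_inv, inv_div]
    have : x * ((y / x - (y / x)⁻¹) / 2) = -(x - y + (y - x) ^ 2 / (2 * y)) := by
      field_simp
      ring
    rw [hinv]
    linarith

lemma mul_sq_le_ip {p q : ℝ} (hp0 : 0 < p) (hp1 : p < 1) (hq : q ∈ Set.Icc (0 : ℝ) 1) :
    p / 2 * (max 0 (1 - q / p)) ^ 2 ≤ ip p q := by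
  have h1 := sub_le_mul_log_div (sub_nonneg.2 hq.2) (sub_pos.2 hp1)
  unfold ip
  rcases le_total q p with h | h
  · have h2 := sub_add_sq_le_mul_log_div hq.1 h hp0
    rw [max_eq_right (sub_nonneg.2 ((div_le_one hp0).2 h))]
    have : p / 2 * (1 - q / p) ^ 2 = (p - q) ^ 2 / (2 * p) := by field_simp
    linarith
  · have h2 := sub_le_mul_log_div hq.1 hp0
    rw [max_eq_left (sub_nonpos.2 ((one_le_div hp0).2 h))]
    linarith

lemma sum_mul_sum_eq_sum_mul_degH {V : Type*} [Fintype V] [DecidableEq V]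
    (H : Finset (Finset V)) (d : Finset V → ℝ) (x : V → ℝ) :
    ∑ A ∈ H, d A * ∑ v ∈ A, x v = ∑ v, x v * degH H d {v} := by
  unfold degH
  simp_rw [Finset.mul_sum]
  rw [Finset.sum_comm]
  refine Finset.sum_congr rfl fun A _ => ?_
  simp [mul_comm]

/-- Lemma `lemma:Phi-p-cH-lower`: if `(H, d)` is a (nonempty) `r`-uniform weighted
hypergraph with `Δ₁(H) ≤ K e(H)/v(H)`, then for all `p ∈ (0,1)` and `ε ∈ (0,1]`,
`Φ_p^H(1−ε) ≥ (ε²/(2K²)) |V| p`. -/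
theorem Phi_lower_bound (r : ℕ) (hr : 1 ≤ r) {V : Type*} [Fintype V] [DecidableEq V]
    (H : Finset (Finset V)) (hne : H.Nonempty) (d : Finset V → ℝ)
    (hunif : ∀ A ∈ H, A.card = r) (hd : ∀ A ∈ H, 0 < d A)
    (K : ℝ) (hK : 0 < K)
    (hΔ : ∀ v : V, degH H d {v} ≤ K * (eTot H d / (Fintype.card V : ℝ)))
    (p ε : ℝ) (hp0 : 0 < p) (hp1 : p < 1) (hε0 : 0 < ε) (hε1 : ε ≤ 1) :
    ε ^ 2 / (2 * K ^ 2) * (Fintype.card V : ℝ) * p ≤ PhiH H d p (1 - ε) := by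
  have hcard : 0 < (Fintype.card V : ℝ) := by
    obtain ⟨A, hA⟩ := hne
    obtain ⟨v, -⟩ := Finset.card_pos.1 (by rw [hunif A hA]; omega)
    exact_mod_cast Fintype.card_pos_iff.2 ⟨v⟩
  have hE : 0 < eTot H d := Finset.sum_pos hd hne
  have hEp : expE H d (fun _ => p) = p ^ r * eTot H d := by
    rw [expE_eq_sum_prod, eTot, Finset.mul_sum]
    refine Finset.sum_congr rfl fun A hA => ?_
    rw [Finset.prod_const, hunif A hA, mul_comm]
  have hpr : 0 < p ^ r := pow_pos hp0 r
  refine le_csInf ⟨_, fun _ => 0, fun _ => by simp, ?_, rfl⟩ ?_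
  · have h0 : expE H d (fun _ => 0) = 0 := by
      rw [expE_eq_sum_prod]
      refine Finset.sum_eq_zero fun A hA => ?_
      rw [Finset.prod_const, hunif A hA, zero_pow (by omega), mul_zero]
    rw [h0, hEp]
    exact mul_nonneg (sub_nonneg.2 hε1) (mul_nonneg hpr.le hE.le)
  · rintro _ ⟨q, hq, hqe, rfl⟩
    set x : V → ℝ := fun v => max 0 (1 - q v / p)
    have hx0 : ∀ v, 0 ≤ x v := fun v => le_max_left _ _
    have hx1 : ∀ v, x v ≤ 1 := fun v =>
      max_le zero_le_one (sub_le_self _ (div_nonneg (hq v).1 hp0.le))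
    have hxq : ∀ v, p * (1 - x v) ≤ q v := fun v => by
      have h : 1 - q v / p ≤ x v := le_max_right _ _
      calc p * (1 - x v) ≤ p * (q v / p) := mul_le_mul_of_nonneg_left (by linarith) hp0.le
        _ = q v := by field_simp
    have hedge : ∀ A ∈ H, p ^ r * (d A * (1 - ∑ v ∈ A, x v)) ≤ d A * ∏ v ∈ A, q v := by
      intro A hA
      have h : p ^ r * ∏ v ∈ A, (1 - x v) ≤ ∏ v ∈ A, q v := by
        rw [← hunif A hA, ← Finset.prod_const, ← Finset.prod_mul_distrib]
        exact Finset.prod_le_prod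
          (fun v _ => mul_nonneg hp0.le (sub_nonneg.2 (hx1 v))) fun v _ => hxq v
      have h' := mul_le_mul_of_nonneg_left (one_sub_sum_le_prod_one_sub A x hx0 hx1) hpr.le
      calc p ^ r * (d A * (1 - ∑ v ∈ A, x v)) = d A * (p ^ r * (1 - ∑ v ∈ A, x v)) := by ring
        _ ≤ _ := mul_le_mul_of_nonneg_left (h'.trans h) (hd A hA).le
    have hdeg : ε * eTot H d ≤ ∑ v, x v * degH H d {v} := by
      have h := Finset.sum_le_sum hedge
      rw [← expE_eq_sum_prod, ← Finset.mul_sum] at h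
      have h2 := h.trans hqe
      rw [hEp, mul_left_comm] at h2
      have h3 := le_of_mul_le_mul_left h2 hpr
      simp_rw [mul_sub, mul_one] at h3
      rw [Finset.sum_sub_distrib, sum_mul_sum_eq_sum_mul_degH] at h3
      change eTot H d - _ ≤ _ at h3
      linarith
    have hsum : ε * Fintype.card V / K ≤ ∑ v, x v := by
      have h : ∑ v, x v * degH H d {v} ≤ (∑ v, x v) * (K * (eTot H d / Fintype.card V)) := by
        rw [Finset.sum_mul]
        exact Finset.sum_le_sum fun v _ => mul_le_mul_of_nonneg_left (hΔ v) (hx0 v)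
      have h2 : eTot H d * ε ≤ eTot H d * ((∑ v, x v) * K / Fintype.card V) := by
        calc eTot H d * ε ≤ (∑ v, x v) * (K * (eTot H d / Fintype.card V)) := by linarith
          _ = _ := by ring
      have h3 := le_of_mul_le_mul_left h2 hE
      rw [le_div_iff₀ hcard] at h3
      rwa [div_le_iff₀ hK]
    have hsq : ε ^ 2 / K ^ 2 * Fintype.card V ≤ ∑ v, x v ^ 2 := by
      have hcs : (∑ v, x v) ^ 2 ≤ Fintype.card V * ∑ v, x v ^ 2 := sq_sum_le_card_mul_sum_sq
      have h := pow_le_pow_left₀ (by positivity) hsum 2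
      refine le_of_mul_le_mul_left ?_ hcard
      calc _ = (ε * Fintype.card V / K) ^ 2 := by ring
        _ ≤ _ := h.trans hcs
    calc ε ^ 2 / (2 * K ^ 2) * Fintype.card V * p
        = p / 2 * (ε ^ 2 / K ^ 2 * Fintype.card V) := by field_simp
      _ ≤ p / 2 * ∑ v, x v ^ 2 := mul_le_mul_of_nonneg_left hsq (by positivity)
      _ = ∑ v, p / 2 * x v ^ 2 := Finset.mul_sum _ _ _
      _ ≤ ∑ v, ip p (q v) := Finset.sum_le_sum fun v _ => mul_sq_le_ip hp0 hp1 (hq v)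

end
end
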